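/- arXiv:1008.2435 — 2 statements merged into one kernel-verified Lean document; each statement's English description precedes it below -/
import Mathlib

section
/- Let 𝔤_λ be a generic oscillator Lie algebra. A linear map ξ : 𝔤_λ → ⋀²𝔤_λ is a Lie bialgebra structure on 𝔤_λ if and only if there exist r ∈ ⋀²S, u₀ ∈ S, and a derivation J of 𝔤_λ commuting with ad_{e₋₁} and satisfying J(e₋₁) = J(e₀) = 0, such that ξ(u) = ad_u† r + 2 e₀ ∧ ((J + ad_{u₀})(u)) for all u ∈ 𝔤_λ, and ω_{r, ad_{e₋₁}† r} − (J† ∘ ad_{e₋₁}†)(r) = 0. Moreover, in this case the dual bracket on 𝔤_λ* is given by: [e₀*, α]* = 2 α∘J − 2 α([e₋₁, u₀]) e₋₁* + ω(r_#(α), ·) and [α, β]* = (ad_{e₋₁}† r)(α,β) e₋₁* for all α, β ∈ S*, and e₋₁* is a central element of (𝔤_λ*, [·,·]*). -/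
open Module LinearMap

noncomputable section

/-- Index type for the basis of an oscillator Lie algebra:
`Sum.inl 0 ↦ e₋₁`, `Sum.inl 1 ↦ e₀`, `Sum.inr (Sum.inl i) ↦ eᵢ`,
`Sum.inr (Sum.inr i) ↦ ěᵢ`. -/
abbrev OscIdx (n : ℕ) := Fin 2 ⊕ (Fin n ⊕ Fin n)

/-- The oscillator Lie algebra `𝔤_λ`: a real Lie algebra `L` together with a basis
`{e₋₁, e₀, e₁, …, eₙ, ě₁, …, ěₙ}` whose nonzero brackets on basis vectors are
`[e₋₁, eⱼ] = λⱼ ěⱼ`, `[e₋₁, ěⱼ] = −λⱼ eⱼ`, `[eⱼ, ěⱼ] = e₀` (all other brackets of the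
basis vectors vanish or follow by antisymmetry; in particular `e₀` is central). -/
structure OscAlg (n : ℕ) (lam : Fin n → ℝ) (L : Type) [LieRing L] [LieAlgebra ℝ L] where
  basis : Basis (OscIdx n) ℝ L
  bracket_em_e : ∀ j, ⁅basis (Sum.inl 0), basis (Sum.inr (Sum.inl j))⁆
      = lam j • basis (Sum.inr (Sum.inr j))
  bracket_em_f : ∀ j, ⁅basis (Sum.inl 0), basis (Sum.inr (Sum.inr j))⁆
      = -lam j • basis (Sum.inr (Sum.inl j))
  bracket_e_f : ∀ i j, ⁅basis (Sum.inr (Sum.inl i)), basis (Sum.inr (Sum.inr j))⁆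
      = if i = j then basis (Sum.inl 1) else 0
  bracket_e_e : ∀ i j, ⁅basis (Sum.inr (Sum.inl i)), basis (Sum.inr (Sum.inl j))⁆ = 0
  bracket_f_f : ∀ i j, ⁅basis (Sum.inr (Sum.inr i)), basis (Sum.inr (Sum.inr j))⁆ = 0
  bracket_e0 : ∀ x : L, ⁅basis (Sum.inl 1), x⁆ = 0

/-- `0 < λ₁ ≤ … ≤ λₙ`: the standing assumption on the parameters of an oscillator
Lie algebra. -/
def OscParam {n : ℕ} (lam : Fin n → ℝ) : Prop := (∀ i, 0 < lam i) ∧ Monotone lam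

/-- Genericity: `0 < λ₁ < … < λₙ` and `λ_k ≠ λ_i + λ_j` for all `i < j < k`. -/
def IsGeneric {n : ℕ} (lam : Fin n → ℝ) : Prop :=
  (∀ i, 0 < lam i) ∧ StrictMono lam ∧
    ∀ i j k : Fin n, i < j → j < k → lam k ≠ lam i + lam j

namespace OscAlg

variable {n : ℕ} {lam : Fin n → ℝ} {L : Type} [LieRing L] [LieAlgebra ℝ L]

/-- `e₋₁`. -/
def em (B : OscAlg n lam L) : L := B.basis (Sum.inl 0)
/-- `e₀`. -/
def e0 (B : OscAlg n lam L) : L := B.basis (Sum.inl 1)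
/-- `eᵢ`. -/
def e (B : OscAlg n lam L) (i : Fin n) : L := B.basis (Sum.inr (Sum.inl i))
/-- `ěᵢ`. -/
def f (B : OscAlg n lam L) (i : Fin n) : L := B.basis (Sum.inr (Sum.inr i))
/-- `e₋₁*`, an element of the dual basis. -/
def em' (B : OscAlg n lam L) : Dual ℝ L := B.basis.coord (Sum.inl 0)
/-- `e₀*`. -/
def e0' (B : OscAlg n lam L) : Dual ℝ L := B.basis.coord (Sum.inl 1)
/-- `eᵢ*`. -/
def e' (B : OscAlg n lam L) (i : Fin n) : Dual ℝ L := B.basis.coord (Sum.inr (Sum.inl i))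
/-- `ěᵢ*`. -/
def f' (B : OscAlg n lam L) (i : Fin n) : Dual ℝ L := B.basis.coord (Sum.inr (Sum.inr i))

/-- The subspace `S` spanned by the `eᵢ, ěᵢ`. -/
def S (B : OscAlg n lam L) : Submodule ℝ L :=
  Submodule.span ℝ (Set.range B.e ∪ Set.range B.f)

/-- The `2`-form `ω` on `𝔤_λ`, viewed as a linear map `𝔤_λ → 𝔤_λ*`:
`ω(e₋₁,·) = ω(e₀,·) = 0`, `ω(eᵢ,eⱼ) = ω(ěᵢ,ěⱼ) = 0`, `ω(eᵢ,ěⱼ) = δᵢⱼ`. -/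
def om (B : OscAlg n lam L) : L →ₗ[ℝ] Dual ℝ L :=
  ∑ i : Fin n, ((B.e' i).smulRight (B.f' i) - (B.f' i).smulRight (B.e' i))

/-- The derivation `J_a` of `𝔤_λ` given by `J_a(e₋₁) = J_a(e₀) = 0`, `J_a(eᵢ) = aᵢ ěᵢ`,
`J_a(ěᵢ) = −aᵢ eᵢ`. -/
def Ja (B : OscAlg n lam L) (a : Fin n → ℝ) : L →ₗ[ℝ] L :=
  B.basis.constr ℝ (Sum.elim (fun _ => (0 : L))
    (Sum.elim (fun i => a i • B.f i) (fun i => -(a i) • B.e i)))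

end OscAlg

section Bivectors

variable {L : Type} [LieRing L] [LieAlgebra ℝ L]

/-- `x ∧ y`, viewed as the linear map `𝔤* → 𝔤`, `α ↦ α(x) y − α(y) x`; this corresponds
to the skew-symmetric bilinear form `(α,β) ↦ α(x)β(y) − α(y)β(x)` on `𝔤*`. -/
def wedge (x y : L) : Dual ℝ L →ₗ[ℝ] L :=
  (Module.Dual.eval ℝ L x).smulRight y - (Module.Dual.eval ℝ L y).smulRight x

/-- A bivector `r ∈ ⋀²𝔤`, identified with the linear map `r_# : 𝔤* → 𝔤` of the
corresponding skew-symmetric bilinear form on `𝔤*` (so `r(α,β) = β(r_#(α))`). -/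
def IsBivector (r : Dual ℝ L →ₗ[ℝ] L) : Prop := ∀ α β : Dual ℝ L, α (r β) = - β (r α)

/-- The coadjoint action `ad*_u α := α ∘ ad_u`. -/
def coad (u : L) : Dual ℝ L →ₗ[ℝ] Dual ℝ L := (LieAlgebra.ad ℝ L u).dualMap

/-- `J† r` for an endomorphism `J` of `𝔤`; in terms of bilinear forms,
`(J† r)(α,β) = r(α∘J, β) + r(α, β∘J)`. -/
def dag (J : L →ₗ[ℝ] L) (r : Dual ℝ L →ₗ[ℝ] L) : Dual ℝ L →ₗ[ℝ] L :=
  r ∘ₗ J.dualMap + J ∘ₗ r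

/-- The adjoint action `ad_u† r` of `u ∈ 𝔤` on bivectors:
`(ad_u† r)(α,β) = r(ad*_u α, β) + r(α, ad*_u β)`. -/
def adDag (u : L) (r : Dual ℝ L →ₗ[ℝ] L) : Dual ℝ L →ₗ[ℝ] L :=
  dag (LieAlgebra.ad ℝ L u) r

/-- The Schouten bracket `[r,r]` of a bivector with itself:
`[r,r](α,β,γ) = 2α([r_#β, r_#γ]) + 2β([r_#γ, r_#α]) + 2γ([r_#α, r_#β])`. -/
def schouten (r : Dual ℝ L →ₗ[ℝ] L) (α β γ : Dual ℝ L) : ℝ :=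
  2 * α ⁅r β, r γ⁆ + 2 * β ⁅r γ, r α⁆ + 2 * γ ⁅r α, r β⁆

/-- `r` is a solution of the classical Yang–Baxter equation: `[r,r] = 0`. -/
def IsCYBE (r : Dual ℝ L →ₗ[ℝ] L) : Prop := ∀ α β γ : Dual ℝ L, schouten r α β γ = 0

/-- `r` is a solution of the generalized classical Yang–Baxter equation:
`ad_u [r,r] = 0` for all `u`. -/
def IsGCYBE (r : Dual ℝ L →ₗ[ℝ] L) : Prop :=
  ∀ (u : L) (α β γ : Dual ℝ L),
    schouten r (coad u α) β γ + schouten r α (coad u β) γ + schouten r α β (coad u γ) = 0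

/-- A derivation of the Lie algebra `L`. -/
def IsDerivation (J : L →ₗ[ℝ] L) : Prop := ∀ x y : L, J ⁅x, y⁆ = ⁅J x, y⁆ + ⁅x, J y⁆

/-- The 1-cocycle condition for `ξ : 𝔤 → ⋀²𝔤` with respect to the adjoint action:
`ξ([u,v]) = ad_u† ξ(v) − ad_v† ξ(u)`. -/
def IsCocycle (ξ : L →ₗ[ℝ] (Dual ℝ L →ₗ[ℝ] L)) : Prop :=
  ∀ u v : L, ξ ⁅u, v⁆ = adDag u (ξ v) - adDag v (ξ u)

/-- The dual bracket `[α,β]*` associated to `ξ : 𝔤 → ⋀²𝔤`: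
`[α,β]*(u) = ξ(u)(α,β)`. -/
def dualBr (ξ : L →ₗ[ℝ] (Dual ℝ L →ₗ[ℝ] L)) (α β : Dual ℝ L) : Dual ℝ L :=
  (β : L →ₗ[ℝ] ℝ) ∘ₗ (ξ.flip α)

/-- `ξ : 𝔤 → ⋀²𝔤` is a Lie bialgebra structure: `ξ` takes values in bivectors, is a
1-cocycle, and the dual bracket satisfies the Jacobi identity. -/
def IsBialgebra (ξ : L →ₗ[ℝ] (Dual ℝ L →ₗ[ℝ] L)) : Prop :=
  (∀ (u : L) (α β : Dual ℝ L), α (ξ u β) = - β (ξ u α)) ∧ IsCocycle ξ ∧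
  ∀ α β γ : Dual ℝ L,
    dualBr ξ (dualBr ξ α β) γ + dualBr ξ (dualBr ξ β γ) α + dualBr ξ (dualBr ξ γ α) β = 0

end Bivectors

namespace OscAlg

variable {n : ℕ} {lam : Fin n → ℝ} {L : Type} [LieRing L] [LieAlgebra ℝ L]

/-- Membership in `⋀²S`: a bivector `r` with `r_#(e₋₁*) = r_#(e₀*) = 0` and
`Im r_# ⊆ S`. -/
def InW2S (B : OscAlg n lam L) (r : Dual ℝ L →ₗ[ℝ] L) : Prop :=
  IsBivector r ∧ r B.em' = 0 ∧ r B.e0' = 0 ∧ ∀ α : Dual ℝ L, r α ∈ B.S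

/-- `ω_{r₁,r₂}(α,β) = (1/2)(ω(r₁_#(α), r₂_#(β)) + ω(r₂_#(α), r₁_#(β)))`. -/
def omPair (B : OscAlg n lam L) (r₁ r₂ : Dual ℝ L →ₗ[ℝ] L) (α β : Dual ℝ L) : ℝ :=
  (1/2) * (B.om (r₁ α) (r₂ β) + B.om (r₂ α) (r₁ β))

end OscAlg

namespace OscAlg

variable {n : ℕ} {lam : Fin n → ℝ} {L : Type} [LieRing L] [LieAlgebra ℝ L]

section Basic

variable (B : OscAlg n lam L)

@[simp] theorem em'_em : B.em' B.em = 1 := by simp [em', em]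
@[simp] theorem em'_e0 : B.em' B.e0 = 0 := by simp [em', e0]
@[simp] theorem em'_e (i : Fin n) : B.em' (B.e i) = 0 := by simp [em', e]
@[simp] theorem em'_f (i : Fin n) : B.em' (B.f i) = 0 := by simp [em', f]
@[simp] theorem e0'_em : B.e0' B.em = 0 := by simp [e0', em]
@[simp] theorem e0'_e0 : B.e0' B.e0 = 1 := by simp [e0', e0]
@[simp] theorem e0'_e (i : Fin n) : B.e0' (B.e i) = 0 := by simp [e0', e]
@[simp] theorem e0'_f (i : Fin n) : B.e0' (B.f i) = 0 := by simp [e0', f]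

theorem om_apply (x y : L) :
    B.om x y = ∑ i, (B.e' i x * B.f' i y - B.f' i x * B.e' i y) := by
  simp [om]

theorem om_skew (x y : L) : B.om x y = -B.om y x := by
  rw [om_apply, om_apply, ← Finset.sum_neg_distrib]
  exact Finset.sum_congr rfl fun i _ => by ring

@[simp] theorem om_self (x : L) : B.om x x = 0 := by
  linarith [B.om_skew x x]

@[simp] theorem om_em : B.om B.em = 0 := by
  ext y; simp [om_apply, e', f', em]

@[simp] theorem om_e0 : B.om B.e0 = 0 := by
  ext y; simp [om_apply, e', f', e0]

@[simp] theorem om_right_em (x : L) : B.om x B.em = 0 := by rw [om_skew]; simp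

@[simp] theorem om_right_e0 (x : L) : B.om x B.e0 = 0 := by rw [om_skew]; simp

@[simp] theorem om_e_right (i : Fin n) (y : L) : B.om (B.e i) y = B.f' i y := by
  simp [om_apply, e', f', e, Finsupp.single_apply]

@[simp] theorem om_f_right (i : Fin n) (y : L) : B.om (B.f i) y = -B.e' i y := by
  simp [om_apply, e', f', f, Finsupp.single_apply]

@[simp] theorem e'_e (i j : Fin n) : B.e' i (B.e j) = if j = i then 1 else 0 := by
  simp [e', e, Finsupp.single_apply]
@[simp] theorem e'_f (i j : Fin n) : B.e' i (B.f j) = 0 := by simp [e', f]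
@[simp] theorem f'_e (i j : Fin n) : B.f' i (B.e j) = 0 := by simp [f', e]
@[simp] theorem f'_f (i j : Fin n) : B.f' i (B.f j) = if j = i then 1 else 0 := by
  simp [f', f, Finsupp.single_apply]

/-- Linear maps out of `𝔤_λ` that agree on the basis vectors are equal. -/
theorem hom_ext {M : Type*} [AddCommGroup M] [Module ℝ M] {φ ψ : L →ₗ[ℝ] M}
    (hm : φ B.em = ψ B.em) (h0 : φ B.e0 = ψ B.e0)
    (he : ∀ i, φ (B.e i) = ψ (B.e i)) (hf : ∀ i, φ (B.f i) = ψ (B.f i)) : φ = ψ := by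
  refine B.basis.ext ?_
  rintro (i | i | i)
  · fin_cases i
    · exact hm
    · exact h0
  · exact he i
  · exact hf i

/-- The operator `ad_{e₋₁}`. -/
def D : L →ₗ[ℝ] L := LieAlgebra.ad ℝ L B.em

theorem D_apply (x : L) : B.D x = ⁅B.em, x⁆ := rfl

@[simp] theorem D_em : B.D B.em = 0 := by simp [D_apply]
@[simp] theorem D_e0 : B.D B.e0 = 0 := by
  rw [D_apply, ← lie_skew, e0, B.bracket_e0, neg_zero]
@[simp] theorem D_e (i : Fin n) : B.D (B.e i) = lam i • B.f i := B.bracket_em_e i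
@[simp] theorem D_f (i : Fin n) : B.D (B.f i) = -lam i • B.e i := B.bracket_em_f i

@[simp] theorem em'_D (x : L) : B.em' (B.D x) = 0 := by
  have : B.em' ∘ₗ B.D = 0 := B.hom_ext (by simp) (by simp) (by simp) (by simp)
  exact LinearMap.congr_fun this x

@[simp] theorem e0'_D (x : L) : B.e0' (B.D x) = 0 := by
  have : B.e0' ∘ₗ B.D = 0 := B.hom_ext (by simp) (by simp) (by simp) (by simp)
  exact LinearMap.congr_fun this x

theorem om_D_left (x y : L) : B.om (B.D x) y = -B.om x (B.D y) := by
  have : B.om ∘ₗ B.D = -(LinearMap.lcomp ℝ ℝ B.D ∘ₗ B.om) := by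
    refine B.hom_ext ?_ ?_ (fun i => ?_) (fun i => ?_) <;>
      refine B.hom_ext ?_ ?_ (fun j => ?_) (fun j => ?_) <;>
      simp <;> split_ifs with h <;> simp_all
  exact LinearMap.congr_fun (LinearMap.congr_fun this x) y

@[simp] theorem e0_lie (x : L) : ⁅B.e0, x⁆ = 0 := B.bracket_e0 x
@[simp] theorem lie_e0 (x : L) : ⁅x, B.e0⁆ = 0 := by rw [← lie_skew, e0_lie, neg_zero]
@[simp] theorem e_lie_e (i j : Fin n) : ⁅B.e i, B.e j⁆ = 0 := B.bracket_e_e i j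
@[simp] theorem f_lie_f (i j : Fin n) : ⁅B.f i, B.f j⁆ = 0 := B.bracket_f_f i j
@[simp] theorem e_lie_f (i j : Fin n) : ⁅B.e i, B.f j⁆ = if i = j then B.e0 else 0 :=
  B.bracket_e_f i j

theorem lie_eq (x y : L) :
    ⁅x, y⁆ = B.em' x • B.D y - B.em' y • B.D x + B.om x y • B.e0 := by
  have basis_left {a : L} (hm : ⁅a, B.em⁆ = B.em' a • B.D B.em - B.D a)
      (he : ∀ j, ⁅a, B.e j⁆ = B.em' a • B.D (B.e j) + B.om a (B.e j) • B.e0)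
      (hf : ∀ j, ⁅a, B.f j⁆ = B.em' a • B.D (B.f j) + B.om a (B.f j) • B.e0) :
      ⁅a, y⁆ = B.em' a • B.D y - B.em' y • B.D a + B.om a y • B.e0 := by
    have : (LieAlgebra.ad ℝ L a : L →ₗ[ℝ] L) =
        B.em' a • B.D - B.em'.smulRight (B.D a) + (B.om a).smulRight B.e0 := by
      refine B.hom_ext ?_ ?_ (fun j => ?_) (fun j => ?_)
      · simpa using hm
      · simp
      · simpa using he j
      · simpa using hf j
    exact LinearMap.congr_fun this y
  have key : -(LieAlgebra.ad ℝ L y : L →ₗ[ℝ] L) =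
      B.em'.smulRight (B.D y) - B.em' y • B.D + (B.om.flip y).smulRight B.e0 := by
    refine B.hom_ext ?_ ?_ (fun i => ?_) (fun i => ?_) <;>
      rw [LinearMap.neg_apply, LieAlgebra.ad_apply, lie_skew] <;>
      refine (basis_left ?_ (fun j => ?_) (fun j => ?_)).trans ?_
    · simp
    · simp [D_apply]
    · simp [D_apply]
    · simp
    · simp
    · simp
    · simp
    · simp
    · rw [← lie_skew, ← D_apply]; simp
    · simp
    · simp [eq_comm (a := i)]
    · simp
    · rw [← lie_skew, ← D_apply]; simp
    · rw [← lie_skew, e_lie_f]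
      simp
    · simp
    · simp
  have := LinearMap.congr_fun key x
  rw [LinearMap.neg_apply, LieAlgebra.ad_apply, lie_skew] at this
  simpa using this

/-- The projection of `𝔤_λ` onto `S` along `e₋₁` and `e₀`. -/
def projS : L →ₗ[ℝ] L :=
  LinearMap.id - B.em'.smulRight B.em - B.e0'.smulRight B.e0

theorem projS_apply (x : L) : B.projS x = x - B.em' x • B.em - B.e0' x • B.e0 := by
  simp [projS]

theorem projS_of {x : L} (hm : B.em' x = 0) (h0 : B.e0' x = 0) : B.projS x = x := by
  simp [projS_apply, hm, h0]

@[simp] theorem em'_projS (x : L) : B.em' (B.projS x) = 0 := by simp [projS_apply]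
@[simp] theorem e0'_projS (x : L) : B.e0' (B.projS x) = 0 := by simp [projS_apply]
@[simp] theorem om_projS (x : L) : B.om (B.projS x) = B.om x := by simp [projS_apply]
@[simp] theorem om_right_projS (x y : L) : B.om x (B.projS y) = B.om x y := by
  simp [projS_apply]
@[simp] theorem D_projS (x : L) : B.D (B.projS x) = B.D x := by simp [projS_apply]
@[simp] theorem projS_D (x : L) : B.projS (B.D x) = B.D x := by simp [projS_apply]

/-- The inverse of the isomorphism `S → S*`, `x ↦ ω(x,·)`, extended by zero. -/
def sharp : Dual ℝ L →ₗ[ℝ] L :=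
  ∑ i, ((Dual.eval ℝ L (B.f i)).smulRight (B.e i) -
    (Dual.eval ℝ L (B.e i)).smulRight (B.f i))

theorem sharp_apply (φ : Dual ℝ L) :
    B.sharp φ = ∑ i, (φ (B.f i) • B.e i - φ (B.e i) • B.f i) := by
  simp [sharp]

@[simp] theorem em'_sharp (φ : Dual ℝ L) : B.em' (B.sharp φ) = 0 := by simp [sharp_apply]
@[simp] theorem e0'_sharp (φ : Dual ℝ L) : B.e0' (B.sharp φ) = 0 := by simp [sharp_apply]

theorem om_sharp (φ : Dual ℝ L) :
    B.om (B.sharp φ) = φ - φ B.em • B.em' - φ B.e0 • B.e0' := by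
  refine B.hom_ext ?_ ?_ (fun j => ?_) (fun j => ?_) <;> simp [sharp_apply]

theorem dual_decomp (φ : Dual ℝ L) :
    φ = B.om (B.sharp φ) + φ B.em • B.em' + φ B.e0 • B.e0' := by
  rw [om_sharp]; abel

/-- Two vectors with the same pairings are equal. -/
theorem vec_ext {x y : L} (hm : B.em' x = B.em' y) (h0 : B.e0' x = B.e0' y)
    (hS : ∀ z, B.om z x = B.om z y) : x = y := by
  apply B.basis.ext_elem
  rintro (i | i | i)
  · fin_cases i
    · exact hm
    · exact h0
  · show B.e' i x = B.e' i y
    simpa using hS (B.f i)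
  · show B.f' i x = B.f' i y
    simpa using hS (B.e i)

theorem sharp_om (x : L) : B.sharp (B.om x) = B.projS x := by
  refine B.vec_ext (by simp) (by simp) fun z => ?_
  rw [om_skew, om_sharp]
  simp [B.om_skew z x]

/-- Two skew-symmetric bilinear forms on the dual with the same components are equal. -/
theorem bivector_ext {r s : Dual ℝ L →ₗ[ℝ] L} (hr : IsBivector r) (hs : IsBivector s)
    (h1 : B.e0' (r B.em') = B.e0' (s B.em'))
    (h2 : ∀ x, B.om x (r B.em') = B.om x (s B.em'))
    (h3 : ∀ x, B.om x (r B.e0') = B.om x (s B.e0'))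
    (h4 : ∀ x y, B.om y (r (B.om x)) = B.om y (s (B.om x))) : r = s := by
  have self (r : Dual ℝ L →ₗ[ℝ] L) (hr : IsBivector r) (α : Dual ℝ L) : α (r α) = 0 := by
    linarith [hr α α]
  have hm : r B.em' = s B.em' :=
    B.vec_ext (by rw [self r hr, self s hs]) h1 h2
  have h0 : r B.e0' = s B.e0' :=
    B.vec_ext (by rw [hr, hs, hm]) (by rw [self r hr, self s hs]) h3
  have hS (x : L) : r (B.om x) = s (B.om x) :=
    B.vec_ext (by rw [hr, hs, hm]) (by rw [hr, hs, h0]) (h4 x)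
  ext α
  rw [B.dual_decomp α]
  simp only [map_add, map_smul, hm, h0, hS]

/-- The inverse of `ad_{e₋₁}` on `S`, extended by zero. -/
def DInv : L →ₗ[ℝ] L := -B.Ja fun i => (lam i)⁻¹

theorem D_DInv (hlam : ∀ i, 0 < lam i) (x : L) : B.D (B.DInv x) = B.projS x := by
  have hne (i : Fin n) : lam i ≠ 0 := (hlam i).ne'
  have : B.D ∘ₗ B.DInv = B.projS := by
    refine B.hom_ext ?_ ?_ (fun j => ?_) (fun j => ?_)
    · simp [DInv, Ja, em, projS_apply, em', e0']
    · simp [DInv, Ja, e0, projS_apply, em', e0']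
    · have h : B.DInv (B.e j) = -((lam j)⁻¹ • B.f j) := by simp [DInv, Ja, e]
      simp [h, projS_apply, smul_smul, hne]
    · have h : B.DInv (B.f j) = (lam j)⁻¹ • B.e j := by simp [DInv, Ja, f]
      simp [h, projS_apply, smul_smul, hne]
  exact LinearMap.congr_fun this x

theorem em'_DInv (x : L) : B.em' (B.DInv x) = 0 := by
  have : B.em' ∘ₗ B.DInv = 0 := by
    refine B.hom_ext ?_ ?_ (fun j => ?_) (fun j => ?_) <;>
      simp [DInv, Ja, em, e0, e, f, em']
  exact LinearMap.congr_fun this x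

theorem e0'_DInv (x : L) : B.e0' (B.DInv x) = 0 := by
  have : B.e0' ∘ₗ B.DInv = 0 := by
    refine B.hom_ext ?_ ?_ (fun j => ?_) (fun j => ?_) <;>
      simp [DInv, Ja, em, e0, e, f, e0']
  exact LinearMap.congr_fun this x

/-- A linear form vanishing on the `ad_{e₋₁}`-eigenplanes vanishes on `S`. -/
theorem eq_zero_of_eigen {φ : L →ₗ[ℝ] ℝ} (h0 : φ B.e0 = 0)
    (h : ∀ (l : ℝ) (s : L), 0 < B.om s (B.D s) → 0 < l → B.em' s = 0 →
      B.D (B.D s) = -l • s → φ s = 0) (hlam : ∀ i, 0 < lam i)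
    {s : L} (hs : B.em' s = 0) : φ s = 0 := by
  have : φ = φ B.em • B.em' := by
    refine B.hom_ext (by simp) (by simp [h0]) (fun i => ?_) (fun i => ?_)
    · rw [h (lam i * lam i) (B.e i) (by simpa using hlam i) (mul_pos (hlam i) (hlam i))
        (by simp) (by simp [smul_smul])]
      simp
    · rw [h (lam i * lam i) (B.f i) (by simpa using hlam i) (mul_pos (hlam i) (hlam i))
        (by simp) (by simp [smul_smul])]
      simp
  rw [this]
  simp [hs]

theorem mem_S_iff (x : L) : x ∈ B.S ↔ B.em' x = 0 ∧ B.e0' x = 0 := by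
  constructor
  · intro hx
    have hle : B.S ≤ LinearMap.ker B.em' ⊓ LinearMap.ker B.e0' := by
      refine Submodule.span_le.2 ?_
      rintro _ (⟨i, rfl⟩ | ⟨i, rfl⟩) <;> simp
    simpa using hle hx
  · rintro ⟨hm, h0⟩
    have : x = B.sharp (B.om x) := by rw [sharp_om, projS_of _ hm h0]
    rw [this, sharp_apply]
    refine Submodule.sum_mem _ fun i _ => Submodule.sub_mem _ ?_ ?_
    · exact Submodule.smul_mem _ _ (Submodule.subset_span (Or.inl ⟨i, rfl⟩))
    · exact Submodule.smul_mem _ _ (Submodule.subset_span (Or.inr ⟨i, rfl⟩))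

theorem coad_em' (u : L) : coad u B.em' = 0 := by
  ext y; simp [coad, B.lie_eq u y]

theorem coad_e0' (u : L) : coad u B.e0' = B.om u := by
  ext y; simp [coad, B.lie_eq u y]

theorem coad_om (u x : L) :
    coad u (B.om x) = -(B.em' u • B.om (B.D x)) - B.om x (B.D u) • B.em' := by
  ext y; simp [coad, B.lie_eq u y, om_D_left, mul_comm]

end Basic

section Cocycle

theorem _root_.IsCocycle.apply {ξ : L →ₗ[ℝ] (Dual ℝ L →ₗ[ℝ] L)} (hc : IsCocycle ξ)
    (u v : L) (α β : Dual ℝ L) :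
    β (ξ ⁅u, v⁆ α) = β (ξ v (coad u α)) + coad u β (ξ v α)
      - β (ξ u (coad v α)) - coad v β (ξ u α) := by
  rw [hc u v]
  simp only [adDag, dag, coad, LinearMap.sub_apply, LinearMap.add_apply,
    LinearMap.comp_apply, map_sub, map_add, LinearMap.dualMap_apply]
  ring

variable (B : OscAlg n lam L) {ξ : L →ₗ[ℝ] (Dual ℝ L →ₗ[ℝ] L)}

theorem coad_e0 (α : Dual ℝ L) : coad B.e0 α = 0 := by
  ext y; simp [coad]

theorem self_zero (hs : ∀ (u : L) (α β : Dual ℝ L), α (ξ u β) = - β (ξ u α)) (u : L)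
    (α : Dual ℝ L) : α (ξ u α) = 0 := by
  linarith [hs u α α]

/-- The form `ω(·, ad_{e₋₁} ·)` is symmetric. -/
theorem om_D_comm (x y : L) : B.om x (B.D y) = B.om y (B.D x) := by
  rw [om_skew, om_D_left, neg_neg]

/-- Bivector-valued cocycles vanish on the centre. -/
theorem cocycle_e0 (hn : 0 < n) (hlam : ∀ i, 0 < lam i)
    (hs : ∀ (u : L) (α β : Dual ℝ L), α (ξ u β) = - β (ξ u α)) (hc : IsCocycle ξ) :
    ξ B.e0 = 0 := by
  have inv (u : L) (α β : Dual ℝ L) :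
      β (ξ B.e0 (coad u α)) + coad u β (ξ B.e0 α) = 0 := by
    have := hc.apply u B.e0 α β
    simp only [coad_e0, lie_e0, map_zero, LinearMap.zero_apply] at this
    linarith
  have hZ (s x : L) (hsm : B.em' s = 0) :
      B.om x (ξ B.e0 (B.om s)) + B.om x (B.D s) * B.e0' (ξ B.e0 B.em') = 0 := by
    have h := inv s B.e0' (B.om x)
    simp only [coad_e0', coad_om, hsm, LinearMap.sub_apply, LinearMap.neg_apply,
      LinearMap.smul_apply, smul_eq_mul, zero_mul] at h
    rw [hs B.e0 B.em' B.e0'] at h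
    linarith
  have hk : B.e0' (ξ B.e0 B.em') = 0 := by
    have h := hZ (B.e ⟨0, hn⟩) (B.e ⟨0, hn⟩) (by simp)
    rw [self_zero hs] at h
    simpa [(hlam _).ne'] using h
  refine B.bivector_ext (hs B.e0) (fun α β => by simp) ?_ (fun x => ?_) (fun x => ?_)
    (fun x y => ?_)
  · simpa using hk
  · have h := inv (B.projS x) B.em' B.e0'
    simpa [coad_em', coad_e0'] using h
  · have h := inv B.em B.e0' (B.om (B.DInv x))
    simpa [coad_e0', coad_om, D_DInv B hlam] using h
  · have h := hZ (B.projS x) y (by simp)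
    simpa [hk] using h

theorem cocycle_apply_S (hn : 0 < n) (hlam : ∀ i, 0 < lam i)
    (hs : ∀ (u : L) (α β : Dual ℝ L), α (ξ u β) = - β (ξ u α)) (hc : IsCocycle ξ)
    {s t : L} (hsm : B.em' s = 0) (htm : B.em' t = 0) (α β : Dual ℝ L) :
    β (ξ t (coad s α)) + coad s β (ξ t α) = β (ξ s (coad t α)) + coad t β (ξ s α) := by
  have h := hc.apply s t α β
  rw [B.lie_eq s t, hsm, htm] at h
  simp only [zero_smul, sub_zero, zero_add, map_smul, B.cocycle_e0 hn hlam hs hc,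
    smul_zero, LinearMap.zero_apply, map_zero] at h
  linarith

theorem cocycle_apply_em (hc : IsCocycle ξ) (s : L) (α β : Dual ℝ L) :
    β (ξ (B.D s) α) = β (ξ s (coad B.em α)) + coad B.em β (ξ s α)
      - β (ξ B.em (coad s α)) - coad s β (ξ B.em α) := hc.apply B.em s α β

theorem coad_em_om (x : L) : coad B.em (B.om x) = -B.om (B.D x) := by
  simp [coad_om]

theorem coad_om_of {u : L} (hu : B.em' u = 0) (x : L) :
    coad u (B.om x) = -(B.om x (B.D u) • B.em') := by
  simp [coad_om, hu]

/-- The `e₋₁ ∧ S` component of a cocycle vanishes on `S`. -/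
theorem cocycle_em'_S (hn : 0 < n) (hlam : ∀ i, 0 < lam i)
    (hs : ∀ (u : L) (α β : Dual ℝ L), α (ξ u β) = - β (ξ u α)) (hc : IsCocycle ξ)
    {s : L} (hsm : B.em' s = 0) (x : L) : B.om x (ξ s B.em') = 0 := by
  have sym {s t : L} (hsm : B.em' s = 0) (htm : B.em' t = 0) :
      B.om s (ξ t B.em') = B.om t (ξ s B.em') := by
    have h := B.cocycle_apply_S hn hlam hs hc hsm htm B.em' B.e0'
    simpa [coad_em', coad_e0'] using h
  have four {s t : L} (hsm : B.em' s = 0) (htm : B.em' t = 0) (x y : L) :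
      B.om y (B.D s) * B.om x (ξ t B.em') - B.om x (B.D s) * B.om y (ξ t B.em')
        = B.om y (B.D t) * B.om x (ξ s B.em') - B.om x (B.D t) * B.om y (ξ s B.em') := by
    have h := B.cocycle_apply_S hn hlam hs hc hsm htm (B.om x) (B.om y)
    simp only [B.coad_om_of hsm, B.coad_om_of htm, LinearMap.neg_apply,
      LinearMap.smul_apply, smul_eq_mul, map_neg, map_smul] at h
    rw [hs t B.em' (B.om x), hs s B.em' (B.om x)] at h
    linarith
  have inv {s : L} (hsm : B.em' s = 0) (x : L) :
      B.om x (ξ (B.D s) B.em') = -B.om (B.D x) (ξ s B.em') := by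
    have h := B.cocycle_apply_em hc s B.em' (B.om x)
    simpa [coad_em', B.coad_em_om, B.coad_om_of hsm, self_zero hs] using h
  have hx : B.om x (ξ s B.em') = B.om (B.projS x) (ξ s B.em') := by simp
  rw [hx]
  have hp : B.em' (B.projS x) = 0 := by simp
  generalize B.projS x = t at hp
  refine B.eq_zero_of_eigen (φ := (B.om t) ∘ₗ (ξ.flip B.em'))
    (by simp [B.cocycle_e0 hn hlam hs hc]) ?_ hlam hsm
  intro l s hg hl hsm hD
  show B.om t (ξ s B.em') = 0
  have hDs := B.em'_D s
  have hD1 : B.om s (ξ (B.D s) B.em') = 0 := by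
    linarith [inv hsm s, sym hsm hDs]
  have hD2 : B.om (B.D s) (ξ (B.D s) B.em') = l * B.om s (ξ s B.em') := by
    rw [inv hsm, hD]; simp
  have hgD : B.om s (B.D (B.D s)) = 0 := by rw [hD]; simp
  have hgDD : B.om (B.D s) (B.D (B.D s)) = l * B.om s (B.D s) := by
    rw [hD, om_skew]; simp
  have hss : B.om s (ξ s B.em') = 0 := by
    have h := four hsm hDs s (B.D s)
    rw [hgD, hgDD, hD1, hD2, om_self] at h
    have : 2 * l * B.om s (B.D s) * B.om s (ξ s B.em') = 0 := by linarith
    simpa [hl.ne', hg.ne'] using this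
  have h := four hDs hp (B.D s) s
  rw [hgD, hgDD, hD1, hD2, hss] at h
  have : l * B.om s (B.D s) * B.om s (ξ t B.em') = 0 := by linarith
  rw [sym hp hsm]
  simpa [hl.ne', hg.ne'] using this

/-- The `⋀²S` component of a cocycle on `S` is determined by its `e₋₁ ∧ e₀` component. -/
theorem cocycle_om_om (hn : 0 < n) (hlam : ∀ i, 0 < lam i)
    (hs : ∀ (u : L) (α β : Dual ℝ L), α (ξ u β) = - β (ξ u α)) (hc : IsCocycle ξ)
    {s t x : L} (hsm : B.em' s = 0) (htm : B.em' t = 0) (hxm : B.em' x = 0) :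
    B.om x (ξ t (B.om s)) = B.om x (B.D t) * B.e0' (ξ s B.em')
      - B.om s (B.D t) * B.e0' (ξ x B.em') := by
  have key {s t : L} (hsm : B.em' s = 0) (htm : B.em' t = 0) (x : L) :
      B.om x (ξ t (B.om s)) + B.om x (B.D s) * B.e0' (ξ t B.em')
        = B.om x (ξ s (B.om t)) + B.om x (B.D t) * B.e0' (ξ s B.em') := by
    have h := B.cocycle_apply_S hn hlam hs hc hsm htm B.e0' (B.om x)
    simp only [coad_e0', B.coad_om_of hsm, B.coad_om_of htm, LinearMap.neg_apply,
      LinearMap.smul_apply, smul_eq_mul] at h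
    rw [hs t B.em' B.e0', hs s B.em' B.e0'] at h
    linarith
  have h1 := key hsm htm x
  have h2 := key htm hxm s
  have h3 := key hxm hsm t
  rw [B.om_D_comm s x, hs _ (B.om s) (B.om t), hs _ (B.om s) (B.om x)] at h2
  rw [B.om_D_comm t x, hs _ (B.om t) (B.om x), B.om_D_comm t s] at h3
  linarith

/-- For a Lie bialgebra structure, the `e₋₁ ∧ e₀` component vanishes on `S`. -/
theorem bialgebra_e0'_em'_S (hn : 0 < n) (hlam : ∀ i, 0 < lam i) (hξ : IsBialgebra ξ)
    {s : L} (hsm : B.em' s = 0) : B.e0' (ξ s B.em') = 0 := by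
  obtain ⟨hs, hc, hj⟩ := hξ
  have h0 := B.cocycle_e0 hn hlam hs hc
  have ham (s : L) : B.om s (ξ B.em B.em') = -B.e0' (ξ (B.D s) B.em') := by
    have h := B.cocycle_apply_em hc s B.em' B.e0'
    simp only [coad_em', coad_e0', map_zero, LinearMap.zero_apply, B.om_em] at h
    linarith
  set k : Dual ℝ L := dualBr ξ B.em' B.e0' with hk
  have hka (u : L) : k u = B.e0' (ξ u B.em') := rfl
  have hk0 : k B.e0 = 0 := by simp [hka, h0]
  set P := B.sharp k with hP
  have hPk {t : L} (ht : B.em' t = 0) : B.om P t = k t := by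
    simp [hP, om_sharp, hk0, ht]
  have main {x t : L} (hx : B.em' x = 0) (ht : B.em' t = 0) :
      k (B.D x) * k t = k x * k (B.D t) := by
    have h := LinearMap.congr_fun (hj B.em' B.e0' (B.om x)) t
    simp only [LinearMap.add_apply, LinearMap.zero_apply] at h
    have e1 : dualBr ξ k (B.om x) t = -(k x * k (B.D t)) := by
      show B.om x (ξ t k) = _
      have hd := B.dual_decomp k
      rw [hk0, zero_smul, add_zero, ← hP] at hd
      have hPP : k P = 0 := by rw [← hPk (by simp [hP]), om_self]
      conv_lhs => rw [hd]
      simp only [map_add, map_smul]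
      rw [B.cocycle_em'_S hn hlam hs hc ht,
        B.cocycle_om_om hn hlam hs hc (by simp [hP]) ht hx, ← hka, ← hka,
        hPk (by simp), hPP]
      simp
      ring
    have e2 : dualBr ξ (dualBr ξ B.e0' (B.om x)) B.em' t = 0 := by
      show B.em' (ξ t _) = 0
      rw [hs, B.dual_decomp (dualBr ξ B.e0' (B.om x))]
      have : dualBr ξ B.e0' (B.om x) B.e0 = 0 := by
        show B.om x (ξ B.e0 B.e0') = 0
        simp [h0]
      simp [this, B.cocycle_em'_S hn hlam hs hc ht, self_zero hs]
    have e3 : dualBr ξ (dualBr ξ (B.om x) B.em') B.e0' t = k (B.D x) * k t := by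
      have : dualBr ξ (B.om x) B.em' = k (B.D x) • B.em' := by
        ext u
        show B.em' (ξ u (B.om x)) = k (B.D x) * B.em' u
        have hu : u = B.projS u + B.em' u • B.em + B.e0' u • B.e0 := by
          rw [projS_apply]; abel
        have hz := B.cocycle_em'_S hn hlam hs hc (B.em'_projS u) x
        rw [hs]
        conv_lhs => rw [hu]
        simp only [map_add, map_smul, h0, LinearMap.add_apply, LinearMap.smul_apply, hz,
          ham, hka]
        simp
        ring
      rw [this]
      show B.e0' (ξ t (k (B.D x) • B.em')) = _
      simp [hka]
    rw [← hk, e1, e2, e3] at h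
    linarith
  show k s = 0
  refine B.eq_zero_of_eigen hk0 ?_ hlam hsm
  intro l s _ hl hsm hD
  have h := main hsm (B.em'_D s)
  rw [hD, map_smul, smul_eq_mul] at h
  have : l * (k s * k s) = 0 := by nlinarith [mul_self_nonneg (k s), mul_self_nonneg (k (B.D s))]
  simpa [hl.ne'] using this

theorem cocycle_e0'_D (hs : ∀ (u : L) (α β : Dual ℝ L), α (ξ u β) = - β (ξ u α))
    (hc : IsCocycle ξ) {s : L} (hsm : B.em' s = 0) (x : L) :
    B.om x (ξ (B.D s) B.e0') = -B.om (B.D x) (ξ s B.e0') - B.om x (ξ B.em (B.om s))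
      - B.om x (B.D s) * B.e0' (ξ B.em B.em') := by
  have h := B.cocycle_apply_em hc s B.e0' (B.om x)
  simp only [coad_e0', om_em, coad_em_om, B.coad_om_of hsm, LinearMap.neg_apply,
    LinearMap.smul_apply, smul_eq_mul, map_zero] at h
  rw [hs B.em B.em' B.e0'] at h
  linarith

/-- For a Lie bialgebra structure, `e₋₁*` is central in the dual. -/
theorem bialgebra_em' (hn : 0 < n) (hlam : ∀ i, 0 < lam i) (hξ : IsBialgebra ξ) (u : L) :
    ξ u B.em' = 0 := by
  have hs := hξ.1
  have hc := hξ.2.1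
  have h0 := B.cocycle_e0 hn hlam hs hc
  have hkm : B.e0' (ξ B.em B.em') = 0 := by
    have h1 := B.cocycle_e0'_D hs hc (s := B.e ⟨0, hn⟩) (by simp) (B.e ⟨0, hn⟩)
    have h2 := B.cocycle_e0'_D hs hc (s := B.f ⟨0, hn⟩) (by simp) (B.f ⟨0, hn⟩)
    rw [self_zero hs] at h1 h2
    simp only [D_e, D_f, map_smul, LinearMap.smul_apply, smul_eq_mul, om_e_right,
      om_f_right, f'_f, e'_e, if_true, neg_mul, mul_one] at h1 h2
    have : lam ⟨0, hn⟩ * B.e0' (ξ B.em B.em') = 0 := by linarith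
    simpa [(hlam _).ne'] using this
  have hm : ξ B.em B.em' = 0 := by
    refine B.vec_ext (by simp [self_zero hs]) (by simpa using hkm) fun z => ?_
    have h := B.cocycle_apply_em hc z B.em' B.e0'
    simp only [coad_em', coad_e0', map_zero, LinearMap.zero_apply, B.om_em,
      B.bialgebra_e0'_em'_S hn hlam hξ (B.em'_D z)] at h
    simp only [map_zero]
    linarith
  have hS : ξ (B.projS u) B.em' = 0 := by
    refine B.vec_ext (by simp [self_zero hs]) ?_ fun z => ?_
    · simpa using B.bialgebra_e0'_em'_S hn hlam hξ (B.em'_projS u)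
    · simpa using B.cocycle_em'_S hn hlam hs hc (B.em'_projS u) z
  have hu : u = B.projS u + B.em' u • B.em + B.e0' u • B.e0 := by
    rw [projS_apply]; abel
  rw [hu]
  simp only [map_add, map_smul, LinearMap.add_apply, LinearMap.smul_apply, hS, hm, h0]
  simp

theorem bialgebra_om_om (hn : 0 < n) (hlam : ∀ i, 0 < lam i) (hξ : IsBialgebra ξ)
    (u x y : L) : B.om y (ξ u (B.om x)) = B.em' u * B.om y (ξ B.em (B.om x)) := by
  have hu : u = B.projS u + B.em' u • B.em + B.e0' u • B.e0 := by
    rw [projS_apply]; abel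
  have h := B.cocycle_om_om hn hlam hξ.1 hξ.2.1 (B.em'_projS x) (B.em'_projS u)
    (B.em'_projS y)
  simp only [B.bialgebra_em' hn hlam hξ, map_zero, mul_zero, sub_zero, om_projS] at h
  conv_lhs => rw [hu]
  simp only [map_add, map_smul, LinearMap.add_apply, LinearMap.smul_apply, h,
    B.cocycle_e0 hn hlam hξ.1 hξ.2.1]
  simp

end Cocycle

section Form

variable (B : OscAlg n lam L)

theorem coad_eq (u : L) (α : Dual ℝ L) :
    coad u α = B.em' u • B.D.dualMap α - α (B.D u) • B.em' + α B.e0 • B.om u := by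
  ext y; simp [coad, B.lie_eq u y, mul_comm]

theorem _root_.dag_isBivector {J : L →ₗ[ℝ] L} {r : Dual ℝ L →ₗ[ℝ] L} (hr : IsBivector r) :
    IsBivector (dag J r) := by
  intro α β
  have h1 := hr α (J.dualMap β)
  have h2 := hr (J.dualMap α) β
  simp only [dag, LinearMap.add_apply, LinearMap.comp_apply, map_add,
    LinearMap.dualMap_apply] at h1 h2 ⊢
  linarith

theorem _root_.adDag_isBivector {r : Dual ℝ L →ₗ[ℝ] L} (hr : IsBivector r) (u : L) :
    IsBivector (adDag u r) := dag_isBivector hr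

variable {B} in
theorem InW2S.em'_apply {r : Dual ℝ L →ₗ[ℝ] L} (hr : B.InW2S r) (α : Dual ℝ L) :
    B.em' (r α) = 0 := ((B.mem_S_iff _).1 (hr.2.2.2 α)).1

variable {B} in
theorem InW2S.adDag_em_em' {r : Dual ℝ L →ₗ[ℝ] L} (hr : B.InW2S r) :
    adDag B.em r B.em' = 0 := by
  have : (LieAlgebra.ad ℝ L B.em : L →ₗ[ℝ] L).dualMap B.em' = 0 := B.coad_em' B.em
  simp [adDag, dag, this, hr.2.1]

variable {B} in
theorem InW2S.adDag_em_e0' {r : Dual ℝ L →ₗ[ℝ] L} (hr : B.InW2S r) :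
    adDag B.em r B.e0' = 0 := by
  have : (LieAlgebra.ad ℝ L B.em : L →ₗ[ℝ] L).dualMap B.e0' = 0 :=
    (B.coad_e0' B.em).trans B.om_em
  simp [adDag, dag, this, hr.2.2.1]

/-- The bilinear form of `ad_u† r + 2 e₀ ∧ (J + ad_{u₀})(u)`. -/
theorem form_apply {r : Dual ℝ L →ₗ[ℝ] L} (hr : B.InW2S r) {u₀ : L} (hu₀ : B.em' u₀ = 0)
    (J : L →ₗ[ℝ] L) (u : L) (α β : Dual ℝ L) :
    β ((adDag u r + (2 : ℝ) •
        wedge B.e0 ((J + (LieAlgebra.ad ℝ L u₀ : L →ₗ[ℝ] L)) u)) α) =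
      α B.e0 * (2 * β (J u) + B.om (r β) u) - β B.e0 * (2 * α (J u) + B.om (r α) u)
      + B.em' u * (β (adDag B.em r α) - 2 * α B.e0 * β (B.D u₀)
        + 2 * β B.e0 * α (B.D u₀)) := by
  have ad_apply (v : L) : adDag v r α = r (coad v α) + ⁅v, r α⁆ := rfl
  have hβ : β (r (B.om u)) = B.om (r β) u := by rw [hr.1, B.om_skew u, neg_neg]
  have hαu := B.om_skew u (r α)
  simp only [LinearMap.add_apply, LinearMap.smul_apply, wedge, LinearMap.sub_apply,
    LinearMap.smulRight_apply, Dual.eval_apply, LieAlgebra.ad_apply, map_add, map_sub,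
    map_smul, smul_eq_mul, ad_apply, B.lie_eq u, B.lie_eq u₀, B.coad_eq u, hr.2.1,
    B.coad_eq B.em, B.lie_eq B.em, hu₀, hr.em'_apply, hβ, hαu]
  simp
  ring

end Form

section Converse

variable (B : OscAlg n lam L)

theorem _root_.adDag_lie (r : Dual ℝ L →ₗ[ℝ] L) (u v : L) :
    adDag ⁅u, v⁆ r = adDag u (adDag v r) - adDag v (adDag u r) := by
  have ad_apply (w : L) (q : Dual ℝ L →ₗ[ℝ] L) (α : Dual ℝ L) :
      adDag w q α = q (coad w α) + ⁅w, q α⁆ := rfl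
  have hcoad (α : Dual ℝ L) :
      coad ⁅u, v⁆ α = coad v (coad u α) - coad u (coad v α) := by
    ext y; simp [coad]
  ext α
  simp only [LinearMap.sub_apply, ad_apply, hcoad, map_sub, lie_add, lie_lie]
  abel

theorem adDag_wedge_e0 (u y : L) : adDag u (wedge B.e0 y) = wedge B.e0 ⁅u, y⁆ := by
  ext α
  simp only [adDag, dag, wedge, LinearMap.add_apply, LinearMap.comp_apply,
    LinearMap.sub_apply, LinearMap.smulRight_apply, Dual.eval_apply,
    LinearMap.dualMap_apply, LieAlgebra.ad_apply, map_sub, map_smul, map_zero,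
    lie_e0]
  module

theorem _root_.IsDerivation.add_ad {J : L →ₗ[ℝ] L} (hJ : IsDerivation J) (u : L) :
    IsDerivation (J + (LieAlgebra.ad ℝ L u : L →ₗ[ℝ] L)) := by
  intro x y
  simp only [LinearMap.add_apply, hJ x y, LieAlgebra.ad_apply, leibniz_lie u x y, add_lie,
    lie_add]
  abel

theorem form_isCocycle {ξ : L →ₗ[ℝ] (Dual ℝ L →ₗ[ℝ] L)} (r : Dual ℝ L →ₗ[ℝ] L)
    {N : L →ₗ[ℝ] L} (hN : IsDerivation N)
    (hξ : ∀ u, ξ u = adDag u r + (2 : ℝ) • wedge B.e0 (N u)) : IsCocycle ξ := by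
  have hadd (u : L) (p q : Dual ℝ L →ₗ[ℝ] L) :
      adDag u (p + (2 : ℝ) • q) = adDag u p + (2 : ℝ) • adDag u q := by
    ext α
    simp only [adDag, dag, LinearMap.add_apply, LinearMap.comp_apply, LinearMap.smul_apply,
      map_add, map_smul, smul_add]
    abel
  have hw (x y : L) : wedge B.e0 (x + y) = wedge B.e0 x + wedge B.e0 y := by
    ext α
    simp only [wedge, LinearMap.sub_apply, LinearMap.add_apply, LinearMap.smulRight_apply,
      Dual.eval_apply, map_add, smul_add, add_smul]
    abel
  have hwn (x : L) : wedge B.e0 (-x) = -wedge B.e0 x := by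
    ext α
    simp [wedge]
    abel
  intro u v
  rw [hξ, hξ, hξ, hadd, hadd, adDag_wedge_e0, adDag_wedge_e0, adDag_lie, hN, hw,
    ← lie_skew v, hwn]
  module

theorem projS_of_comm (hlam : ∀ i, 0 < lam i) {J : L →ₗ[ℝ] L}
    (hcomm : J ∘ₗ (LieAlgebra.ad ℝ L B.em : L →ₗ[ℝ] L)
      = (LieAlgebra.ad ℝ L B.em : L →ₗ[ℝ] L) ∘ₗ J)
    (hJm : J B.em = 0) (hJ0 : J B.e0 = 0) (x : L) :
    B.em' (J x) = 0 ∧ B.e0' (J x) = 0 := by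
  have h1 : J x = J (B.projS x) := by simp [projS_apply, hJm, hJ0]
  have h2 : J (B.D (B.DInv x)) = B.D (J (B.DInv x)) :=
    LinearMap.congr_fun hcomm (B.DInv x)
  rw [h1, ← B.D_DInv hlam, h2]
  simp

/-- The linear map `α ↦ [e₀*, α]*`, up to a multiple of `e₋₁*`. -/
def dualAd (r : Dual ℝ L →ₗ[ℝ] L) (J : L →ₗ[ℝ] L) : Dual ℝ L →ₗ[ℝ] Dual ℝ L :=
  (2 : ℝ) • J.dualMap + B.om ∘ₗ r

theorem dualAd_apply (r : Dual ℝ L →ₗ[ℝ] L) (J : L →ₗ[ℝ] L) (α : Dual ℝ L) (u : L) :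
    B.dualAd r J α u = 2 * α (J u) + B.om (r α) u := by
  simp [dualAd]

theorem form_jacobi {ξ : L →ₗ[ℝ] (Dual ℝ L →ₗ[ℝ] L)} {r : Dual ℝ L →ₗ[ℝ] L}
    (hr : B.InW2S r) {u₀ : L} (hu₀ : B.em' u₀ = 0) {J : L →ₗ[ℝ] L}
    (hJX : ∀ x, B.em' (J x) = 0) (hJ0 : J B.e0 = 0)
    (hξ : ∀ u : L, ξ u = adDag u r + (2 : ℝ) •
      wedge B.e0 ((J + (LieAlgebra.ad ℝ L u₀ : L →ₗ[ℝ] L)) u))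
    (α β γ : Dual ℝ L) (u : L) :
    (dualBr ξ (dualBr ξ α β) γ + dualBr ξ (dualBr ξ β γ) α + dualBr ξ (dualBr ξ γ α) β) u
      = -2 * B.em' u *
        (α B.e0 * (B.omPair r (adDag B.em r) β γ - γ (dag J (adDag B.em r) β))
        + β B.e0 * (B.omPair r (adDag B.em r) γ α - α (dag J (adDag B.em r) γ))
        + γ B.e0 * (B.omPair r (adDag B.em r) α β - β (dag J (adDag B.em r) α))) := by
  set E := adDag B.em r with hE
  have hEbiv : IsBivector E := dag_isBivector hr.1
  have hEX : E B.em' = 0 := hr.adDag_em_em'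
  set Φ := B.dualAd r J with hΦ
  have hΦX : Φ B.em' = 0 := by
    ext u; simp [hΦ, dualAd_apply, hJX, hr.2.1]
  have hΦ0 (α : Dual ℝ L) : Φ α B.e0 = 0 := by
    simp [hΦ, dualAd_apply, hJ0]
  have br (α β : Dual ℝ L) : dualBr ξ α β = α B.e0 • Φ β - β B.e0 • Φ α
      + (β (E α) - 2 * α B.e0 * β (B.D u₀) + 2 * β B.e0 * α (B.D u₀)) • B.em' := by
    ext u
    show β (ξ u α) = _
    rw [hξ, B.form_apply hr hu₀]
    simp only [hΦ, LinearMap.add_apply, LinearMap.sub_apply, LinearMap.smul_apply,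
      smul_eq_mul, dualAd_apply]
    ring
  have hQ (β γ : Dual ℝ L) : γ (E (Φ β)) - β (E (Φ γ))
      = -2 * (B.omPair r E β γ - γ (dag J E β)) := by
    have h (β γ : Dual ℝ L) :
        γ (E (Φ β)) = 2 * γ (E (J.dualMap β)) + γ (E (B.om (r β))) := by
      simp [hΦ, dualAd]
    have h1 := hEbiv β (J.dualMap γ)
    rw [LinearMap.dualMap_apply] at h1
    have h2 := B.om_skew (E β) (r γ)
    simp only [h, hEbiv γ (B.om (r β)), hEbiv β (B.om (r γ)), h1, omPair, dag, h2,
      LinearMap.add_apply, LinearMap.comp_apply, map_add]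
    ring
  simp only [br, LinearMap.add_apply, LinearMap.sub_apply, LinearMap.smul_apply, map_add,
    map_sub, map_smul, smul_eq_mul, hΦX, hEX, hΦ0, em'_e0, em'_D, map_zero, LinearMap.zero_apply]
  linear_combination B.em' u * (α B.e0 * hQ β γ + β B.e0 * hQ γ α + γ B.e0 * hQ α β)

end Converse

section Classification

variable (B : OscAlg n lam L)

theorem isDerivation_of_om {J : L →ₗ[ℝ] L} (hJX : ∀ x, B.em' (J x) = 0)
    (hJ0 : J B.e0 = 0) (hcomm : ∀ x, J (B.D x) = B.D (J x))
    (hom : ∀ x y, B.om x (J y) = B.om y (J x)) : IsDerivation J := by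
  intro x y
  have h := hom x y
  rw [B.om_skew y (J x)] at h
  rw [B.lie_eq x y, B.lie_eq (J x) y, B.lie_eq x (J y), hJX, hJX, h]
  simp only [map_add, map_sub, map_smul, hJ0, hcomm]
  module

/-- Every Lie bialgebra structure has the stated form, Jacobi condition aside. -/
theorem bialgebra_exists_form (hn : 0 < n) (hlam : ∀ i, 0 < lam i)
    {ξ : L →ₗ[ℝ] (Dual ℝ L →ₗ[ℝ] L)} (hξ : IsBialgebra ξ) :
    ∃ (r : Dual ℝ L →ₗ[ℝ] L) (u₀ : L) (J : L →ₗ[ℝ] L),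
      B.InW2S r ∧ u₀ ∈ B.S ∧ IsDerivation J ∧ (∀ x, J (B.D x) = B.D (J x)) ∧
      J B.em = 0 ∧ J B.e0 = 0 ∧
      ∀ u : L, ξ u = adDag u r + (2 : ℝ) •
        wedge B.e0 ((J + (LieAlgebra.ad ℝ L u₀ : L →ₗ[ℝ] L)) u) := by
  have hs := hξ.1
  have hc := hξ.2.1
  have h0 := B.cocycle_e0 hn hlam hs hc
  have hX := B.bialgebra_em' hn hlam hξ
  -- `M` encodes the `e₀ ∧ S` component of `ξ` on `S`, and `M'` is its `ω`-adjoint.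
  obtain ⟨M, hMdef⟩ : ∃ M : L →ₗ[ℝ] L, M = B.projS ∘ₗ ξ.flip B.e0' ∘ₗ B.projS := ⟨_, rfl⟩
  obtain ⟨M', hM'def⟩ : ∃ M' : L →ₗ[ℝ] L, M' = B.sharp ∘ₗ M.dualMap ∘ₗ B.om := ⟨_, rfl⟩
  have hM (x s : L) : B.om x (M s) = B.om x (ξ (B.projS s) B.e0') := by simp [hMdef]
  have hMm : M B.em = 0 := by simp [hMdef, projS_apply]
  have hM0 : M B.e0 = 0 := by simp [hMdef, projS_apply]
  have hMX (x : L) : B.em' (M x) = 0 := by simp [hMdef]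
  have hMZ (x : L) : B.e0' (M x) = 0 := by simp [hMdef]
  have hMp (x : L) : M (B.projS x) = M x := by simp [projS_apply, hMm, hM0]
  have hM'X (x : L) : B.em' (M' x) = 0 := by simp [hM'def]
  have hM'Z (x : L) : B.e0' (M' x) = 0 := by simp [hM'def]
  have hM' (x s : L) : B.om x (M' s) = -B.om s (M x) := by
    rw [om_skew, hM'def]
    simp [om_sharp, hMm, hM0]
  obtain ⟨r, hrdef⟩ : ∃ r : Dual ℝ L →ₗ[ℝ] L, r = (1 / 2 : ℝ) • ((M + M') ∘ₗ B.sharp) :=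
    ⟨_, rfl⟩
  obtain ⟨J, hJdef⟩ : ∃ J : L →ₗ[ℝ] L, J = (1 / 4 : ℝ) • (M - M') := ⟨_, rfl⟩
  have hr (x : L) (α : Dual ℝ L) :
      B.om x (r α) = (1 / 2) * (B.om x (M (B.sharp α)) - B.om (B.sharp α) (M x)) := by
    simp [hrdef, hM']; ring
  have hrom (x y : L) : B.om x (r (B.om y)) = (1 / 2) * (B.om x (M y) - B.om y (M x)) := by
    simp [hr, sharp_om, hMp]
  have hJ (x s : L) : B.om x (J s) = (1 / 4) * (B.om x (M s) + B.om s (M x)) := by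
    simp [hJdef, hM']
  have hrX (α : Dual ℝ L) : B.em' (r α) = 0 := by simp [hrdef, hMX, hM'X]
  have hrZ (α : Dual ℝ L) : B.e0' (r α) = 0 := by simp [hrdef, hMZ, hM'Z]
  have hr_apply (α β : Dual ℝ L) : β (r α) = B.om (B.sharp β) (r α) := by
    simp [om_sharp, hrX, hrZ]
  have hrS : B.InW2S r := by
    refine ⟨fun α β => ?_, ?_, ?_, fun α => (B.mem_S_iff _).2 ⟨hrX α, hrZ α⟩⟩
    · rw [hr_apply, hr_apply α β, hr, hr]; ring
    · simp [hrdef, sharp_apply]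
    · simp [hrdef, sharp_apply]
  have hJX (x : L) : B.em' (J x) = 0 := by simp [hJdef, hMX, hM'X]
  have hJZ (x : L) : B.e0' (J x) = 0 := by simp [hJdef, hMZ, hM'Z]
  have hJm : J B.em = 0 := by simp [hJdef, hMm, hM'def]
  have hJ0 : J B.e0 = 0 := by simp [hJdef, hM0, hM'def]
  have hT (x y : L) :
      B.om y (ξ B.em (B.om x)) = -B.om y (M (B.D x)) - B.om (B.D y) (M x) := by
    have h := B.cocycle_e0'_D hs hc (B.em'_projS x) y
    simp only [hX, map_zero, mul_zero, sub_zero, om_projS, D_projS] at h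
    rw [hM, hM, projS_D]
    linarith
  have hTs (x y : L) := (hT x y).symm.trans ((hs B.em (B.om y) (B.om x)).trans
    (congrArg Neg.neg (hT y x)))
  have hcomm (x : L) : J (B.D x) = B.D (J x) := by
    refine B.vec_ext (by simp [hJX]) (by simp [hJZ]) fun z => ?_
    have h := B.om_D_left z (J x)
    rw [hJ] at h ⊢
    linarith [hTs x z]
  refine ⟨r, -(1 / 2 : ℝ) • B.DInv (ξ B.em B.e0'), J, hrS, ?_,
    B.isDerivation_of_om hJX hJ0 hcomm fun x y => by rw [hJ, hJ]; ring,
    hcomm, hJm, hJ0, fun u => ?_⟩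
  · rw [mem_S_iff]
    simp [em'_DInv, e0'_DInv]
  have hform := B.form_apply hrS (u₀ := -(1 / 2 : ℝ) • B.DInv (ξ B.em B.e0'))
    (by simp [em'_DInv]) J u
  have hu : u = B.projS u + B.em' u • B.em + B.e0' u • B.e0 := by
    rw [projS_apply]; abel
  refine B.bivector_ext (hs u) (fun α β => ?_) ?_ (fun x => ?_) (fun x => ?_)
    (fun x y => ?_)
  · rw [hform, hform, adDag_isBivector hrS.1 B.em α β]
    ring
  · rw [hform]
    simp [hX, hJX, hrS.2.1, hrS.adDag_em_em']
  · rw [hform]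
    simp [hX, hrS.adDag_em_em']
  · rw [hform, hrS.adDag_em_e0', B.om_skew (r (B.om x)) u, hrom, hJ]
    conv_lhs => rw [hu]
    simp [D_DInv B hlam, h0, hM]
    ring
  · rw [hform, B.bialgebra_om_om hn hlam hξ]
    have had : B.om y (adDag B.em r (B.om x))
        = -B.om y (r (B.om (B.D x))) - B.om (B.D y) (r (B.om x)) := by
      show B.om y (r (coad B.em (B.om x)) + B.D (r (B.om x))) = _
      rw [coad_em_om, om_D_left]
      simp
    have h1 := hTs x y
    rw [had, hrom, hrom, hT]
    simp only [om_right_e0, mul_zero, zero_mul, sub_zero, add_zero, zero_add]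
    linear_combination (B.em' u / 2) * h1

end Classification

end OscAlg

/-- **Theorem (Lie bialgebra structures on generic oscillator Lie algebras).**
Let `𝔤_λ` be a generic oscillator Lie algebra.  Then `ξ : 𝔤_λ → ⋀²𝔤_λ` defines a Lie
bialgebra structure on `𝔤_λ` if and only if there exist `r ∈ ⋀²S`, `u₀ ∈ S` and a
derivation `J` of `𝔤_λ` commuting with `ad_{e₋₁}` with `J(e₋₁) = J(e₀) = 0` such that
`ξ(u) = ad_u† r + 2 e₀ ∧ ((J + ad_{u₀})(u))` and
`ω_{r, ad_{e₋₁}† r} − (J† ∘ ad_{e₋₁}†)(r) = 0`.  Moreover, in this case the dual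
bracket is given by `[e₀*, α]* = 2 α∘J − 2 α([e₋₁,u₀]) e₋₁* + ω(r_#(α), ·)` and
`[α, β]* = (ad_{e₋₁}† r)(α,β) e₋₁*` for `α, β ∈ S*`, and `e₋₁*` is central. -/
theorem oscillator_bialgebra_classification
    {n : ℕ} (hn : 0 < n) {lam : Fin n → ℝ} (hgen : IsGeneric lam)
    {L : Type} [LieRing L] [LieAlgebra ℝ L] (B : OscAlg n lam L)
    (ξ : L →ₗ[ℝ] (Dual ℝ L →ₗ[ℝ] L)) :
    (IsBialgebra ξ ↔
      ∃ (r : Dual ℝ L →ₗ[ℝ] L) (u₀ : L) (J : L →ₗ[ℝ] L),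
        B.InW2S r ∧ u₀ ∈ B.S ∧ IsDerivation J ∧
        (J ∘ₗ (LieAlgebra.ad ℝ L B.em : L →ₗ[ℝ] L)
          = (LieAlgebra.ad ℝ L B.em : L →ₗ[ℝ] L) ∘ₗ J) ∧
        J B.em = 0 ∧ J B.e0 = 0 ∧
        (∀ u : L,
          ξ u = adDag u r + (2 : ℝ) •
            wedge B.e0 ((J + (LieAlgebra.ad ℝ L u₀ : L →ₗ[ℝ] L)) u)) ∧
        (∀ α β : Dual ℝ L,
          B.omPair r (adDag B.em r) α β - β (dag J (adDag B.em r) α) = 0)) ∧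
    (∀ (r : Dual ℝ L →ₗ[ℝ] L) (u₀ : L) (J : L →ₗ[ℝ] L),
      B.InW2S r → u₀ ∈ B.S → IsDerivation J →
      (J ∘ₗ (LieAlgebra.ad ℝ L B.em : L →ₗ[ℝ] L)
        = (LieAlgebra.ad ℝ L B.em : L →ₗ[ℝ] L) ∘ₗ J) →
      J B.em = 0 → J B.e0 = 0 →
      (∀ u : L,
        ξ u = adDag u r + (2 : ℝ) •
          wedge B.e0 ((J + (LieAlgebra.ad ℝ L u₀ : L →ₗ[ℝ] L)) u)) →
      (∀ α β : Dual ℝ L,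
        B.omPair r (adDag B.em r) α β - β (dag J (adDag B.em r) α) = 0) →
      ((∀ α : Dual ℝ L, α B.em = 0 → α B.e0 = 0 →
          dualBr ξ B.e0' α
            = (2 : ℝ) • (J.dualMap α) - (2 * α ⁅B.em, u₀⁆) • B.em' + B.om (r α)) ∧
       (∀ α β : Dual ℝ L, α B.em = 0 → α B.e0 = 0 → β B.em = 0 → β B.e0 = 0 →
          dualBr ξ α β = (β (adDag B.em r α)) • B.em') ∧
       (∀ α : Dual ℝ L, dualBr ξ B.em' α = 0))) := by
  have hlam := hgen.1
  refine ⟨⟨fun hξ => ?_, ?_⟩, ?_⟩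
  · obtain ⟨r, u₀, J, hr, hu₀, hJ, hcomm, hJm, hJ0, hform⟩ := B.bialgebra_exists_form hn hlam hξ
    have hcomm' : J ∘ₗ (LieAlgebra.ad ℝ L B.em : L →ₗ[ℝ] L)
        = (LieAlgebra.ad ℝ L B.em : L →ₗ[ℝ] L) ∘ₗ J := LinearMap.ext hcomm
    have hJS := B.projS_of_comm hlam hcomm' hJm hJ0
    refine ⟨r, u₀, J, hr, hu₀, hJ, hcomm', hJm, hJ0, hform, fun α β => ?_⟩
    have hjac := B.form_jacobi hr ((B.mem_S_iff _).1 hu₀).1 (fun x => (hJS x).1) hJ0 hform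
      B.e0' α β B.em
    rw [hξ.2.2] at hjac
    have hJd : J.dualMap B.e0' = 0 := by
      ext x; simp [(hJS x).2]
    have hZ : adDag B.em r B.e0' = 0 := hr.adDag_em_e0'
    have hskew := dag_isBivector (J := J) (adDag_isBivector hr.1 B.em) B.e0' β
    have hdag : dag J (adDag B.em r) B.e0' = 0 := by simp [dag, hJd, hZ]
    simp only [hdag, hskew, OscAlg.omPair, hZ, hr.2.2.1] at hjac ⊢
    simp only [OscAlg.e0'_e0, OscAlg.em'_em, map_zero, LinearMap.zero_apply] at hjac
    linarith
  · rintro ⟨r, u₀, J, hr, hu₀, hJ, hcomm, hJm, hJ0, hform, hcond⟩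
    have hu := ((B.mem_S_iff _).1 hu₀).1
    have hJS := B.projS_of_comm hlam hcomm hJm hJ0
    refine ⟨fun u α β => ?_, B.form_isCocycle r (hJ.add_ad u₀) hform, fun α β γ => ?_⟩
    · rw [hform, B.form_apply hr hu, B.form_apply hr hu, adDag_isBivector hr.1 B.em α β]
      ring
    · ext u
      rw [B.form_jacobi hr hu (fun x => (hJS x).1) hJ0 hform, hcond, hcond, hcond]
      simp
  · intro r u₀ J hr hu₀ hJ hcomm hJm hJ0 hform _
    have hu := ((B.mem_S_iff _).1 hu₀).1
    have hJS := B.projS_of_comm hlam hcomm hJm hJ0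
    have br (α β : Dual ℝ L) (u : L) : dualBr ξ α β u = _ :=
      (congrArg (fun q => β (q α)) (hform u)).trans (B.form_apply hr hu J u α β)
    refine ⟨fun α hαm hα0 => ?_, fun α β hαm hα0 hβm hβ0 => ?_, fun α => ?_⟩
    · ext u
      rw [br, hr.adDag_em_e0']
      simp [hα0, ← OscAlg.D_apply]
      ring
    · ext u
      rw [br]
      simp [hα0, hβ0, mul_comm]
    · ext u
      rw [br, hr.adDag_em_em', hr.2.1]
      simp [(hJS _).1]
end
end

section
/- Let 𝔤_λ be an oscillator Lie algebra and ξ : 𝔤_λ → ⋀²𝔤_λ a 1-cocycle with respect to the adjoint action. Then for any i, j ∈ {1,…,n} with i ≠ j: b_{i,j}(e_i) = b_{i,j}(e_j) = 0; c_{j,j}(ě_i) = c_{j,j}(e_i) = c_{i,j}(e_i) = c_{i,j}(ě_j) = c_{i,i}(e₋₁) = 0; and b̌_{i,j}(ě_i) = b̌_{i,j}(ě_j) = 0. -/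
open Module LinearMap

noncomputable section

/-- The cocycle condition evaluated on a pair of linear forms. -/
theorem IsCocycle.apply_lie {L : Type} [LieRing L] [LieAlgebra ℝ L]
    {ξ : L →ₗ[ℝ] (Dual ℝ L →ₗ[ℝ] L)} (hξ : IsCocycle ξ) (u v : L) (α β : Dual ℝ L) :
    β (ξ ⁅u, v⁆ α) = β (ξ v (coad u α)) + coad u β (ξ v α)
      - β (ξ u (coad v α)) - coad v β (ξ u α) := by
  rw [hξ u v]
  simp only [adDag, dag, coad, LinearMap.sub_apply, LinearMap.add_apply, LinearMap.comp_apply,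
    LinearMap.dualMap_apply, map_sub, map_add]
  ring

namespace OscAlg

variable {n : ℕ} {lam : Fin n → ℝ} {L : Type} [LieRing L] [LieAlgebra ℝ L]

theorem lie_em_e (B : OscAlg n lam L) (j : Fin n) : ⁅B.em, B.e j⁆ = lam j • B.f j :=
  B.bracket_em_e j

theorem lie_em_f (B : OscAlg n lam L) (j : Fin n) : ⁅B.em, B.f j⁆ = -lam j • B.e j :=
  B.bracket_em_f j

theorem lie_e_e (B : OscAlg n lam L) (i j : Fin n) : ⁅B.e i, B.e j⁆ = 0 :=
  B.bracket_e_e i j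

theorem lie_f_f (B : OscAlg n lam L) (i j : Fin n) : ⁅B.f i, B.f j⁆ = 0 :=
  B.bracket_f_f i j

theorem lie_e_f_of_ne (B : OscAlg n lam L) {i j : Fin n} (hij : i ≠ j) :
    ⁅B.e i, B.f j⁆ = 0 :=
  (B.bracket_e_f i j).trans (if_neg hij)

theorem lie_basis_e0 (B : OscAlg n lam L) (x : L) : ⁅x, B.basis (Sum.inl 1)⁆ = 0 := by
  rw [← lie_skew, B.bracket_e0, neg_zero]

theorem lie_e_em (B : OscAlg n lam L) (j : Fin n) :
    ⁅B.basis (Sum.inr (Sum.inl j)), B.basis (Sum.inl 0)⁆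
      = -(lam j • B.basis (Sum.inr (Sum.inr j))) := by
  rw [← lie_skew, B.bracket_em_e]

theorem lie_f_em (B : OscAlg n lam L) (j : Fin n) :
    ⁅B.basis (Sum.inr (Sum.inr j)), B.basis (Sum.inl 0)⁆
      = lam j • B.basis (Sum.inr (Sum.inl j)) := by
  rw [← lie_skew, B.bracket_em_f, neg_smul, neg_neg]

theorem lie_f_e (B : OscAlg n lam L) (i j : Fin n) :
    ⁅B.basis (Sum.inr (Sum.inr i)), B.basis (Sum.inr (Sum.inl j))⁆
      = -(if j = i then B.basis (Sum.inl 1) else 0) := by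
  rw [← lie_skew, B.bracket_e_f]

theorem coad_em_e0' (B : OscAlg n lam L) : coad B.em B.e0' = 0 := by
  refine B.basis.ext ?_
  rintro (k | k | k)
  · fin_cases k <;> simp [coad, em, e0', B.lie_basis_e0]
  · simp [coad, em, e0', B.bracket_em_e]
  · simp [coad, em, e0', B.bracket_em_f]

theorem coad_em_e' (B : OscAlg n lam L) (j : Fin n) : coad B.em (B.e' j) = -lam j • B.f' j := by
  refine B.basis.ext ?_
  rintro (k | k | k)
  · fin_cases k <;> simp [coad, em, e', f', B.lie_basis_e0]
  · by_cases hk : k = j <;> simp [coad, em, e', f', B.bracket_em_e, hk]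
  · by_cases hk : k = j <;> simp [coad, em, e', f', B.bracket_em_f, hk]

theorem coad_em_f' (B : OscAlg n lam L) (j : Fin n) : coad B.em (B.f' j) = lam j • B.e' j := by
  refine B.basis.ext ?_
  rintro (k | k | k)
  · fin_cases k <;> simp [coad, em, e', f', B.lie_basis_e0]
  · by_cases hk : k = j <;> simp [coad, em, e', f', B.bracket_em_e, hk]
  · by_cases hk : k = j <;> simp [coad, em, e', f', B.bracket_em_f, hk]

theorem coad_e_e0' (B : OscAlg n lam L) (j : Fin n) : coad (B.e j) B.e0' = B.f' j := by
  refine B.basis.ext ?_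
  rintro (k | k | k)
  · fin_cases k <;> simp [coad, e, e0', f', B.lie_e_em, B.lie_basis_e0]
  · simp [coad, e, e0', f', B.bracket_e_e]
  · by_cases hk : j = k <;> simp [coad, e, e0', f', B.bracket_e_f, hk]

theorem coad_e_e' (B : OscAlg n lam L) (i j : Fin n) : coad (B.e i) (B.e' j) = 0 := by
  refine B.basis.ext ?_
  rintro (k | k | k)
  · fin_cases k <;> simp [coad, e, e', B.lie_e_em, B.lie_basis_e0]
  · simp [coad, e, e', B.bracket_e_e]
  · by_cases hk : i = k <;> simp [coad, e, e', B.bracket_e_f, hk]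

theorem coad_e_f'_of_ne (B : OscAlg n lam L) {i j : Fin n} (hij : i ≠ j) :
    coad (B.e i) (B.f' j) = 0 := by
  refine B.basis.ext ?_
  rintro (k | k | k)
  · fin_cases k <;> simp [coad, e, f', B.lie_e_em, B.lie_basis_e0, hij]
  · simp [coad, e, f', B.bracket_e_e]
  · by_cases hk : i = k <;> simp [coad, e, f', B.bracket_e_f, hk]

theorem coad_f_e0' (B : OscAlg n lam L) (j : Fin n) : coad (B.f j) B.e0' = -B.e' j := by
  refine B.basis.ext ?_
  rintro (k | k | k)
  · fin_cases k <;> simp [coad, f, e0', e', B.lie_f_em, B.lie_basis_e0]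
  · by_cases hk : k = j <;> simp [coad, f, e0', e', B.lie_f_e, hk]
  · simp [coad, f, e0', e', B.bracket_f_f]

theorem coad_f_e'_of_ne (B : OscAlg n lam L) {i j : Fin n} (hij : i ≠ j) :
    coad (B.f i) (B.e' j) = 0 := by
  refine B.basis.ext ?_
  rintro (k | k | k)
  · fin_cases k <;> simp [coad, f, e', B.lie_f_em, B.lie_basis_e0, hij]
  · by_cases hk : k = i <;> simp [coad, f, e', B.lie_f_e, hk]
  · simp [coad, f, e', B.bracket_f_f]

theorem coad_f_f' (B : OscAlg n lam L) (i j : Fin n) : coad (B.f i) (B.f' j) = 0 := by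
  refine B.basis.ext ?_
  rintro (k | k | k)
  · fin_cases k <;> simp [coad, f, f', B.lie_f_em, B.lie_basis_e0]
  · by_cases hk : k = i <;> simp [coad, f, f', B.lie_f_e, hk]
  · simp [coad, f, f', B.bracket_f_f]

end OscAlg

/-- **Proposition.** For a 1-cocycle `ξ` on an oscillator Lie algebra and `i ≠ j`:
`b_{i,j}(e_i) = b_{i,j}(e_j) = 0`,
`c_{j,j}(ě_i) = c_{j,j}(e_i) = c_{i,j}(e_i) = c_{i,j}(ě_j) = c_{i,i}(e₋₁) = 0`, and
`b̌_{i,j}(ě_i) = b̌_{i,j}(ě_j) = 0`, where `b_{i,j}(u) = ξ(u)(eᵢ*, eⱼ*)`,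
`b̌_{i,j}(u) = ξ(u)(ěᵢ*, ěⱼ*)`, `c_{i,j}(u) = ξ(u)(eᵢ*, ěⱼ*)`. -/
theorem oscillator_cocycle_coefficients_vanish
    {n : ℕ} (hn : 0 < n) {lam : Fin n → ℝ} (hlam : OscParam lam)
    {L : Type} [LieRing L] [LieAlgebra ℝ L] (B : OscAlg n lam L)
    (ξ : L →ₗ[ℝ] (Dual ℝ L →ₗ[ℝ] L))
    (hskew : ∀ (u : L) (α β : Dual ℝ L), α (ξ u β) = - β (ξ u α))
    (hcoc : IsCocycle ξ)
    (i j : Fin n) (hij : i ≠ j) :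
    B.e' j (ξ (B.e i) (B.e' i)) = 0 ∧
    B.e' j (ξ (B.e j) (B.e' i)) = 0 ∧
    B.f' j (ξ (B.f i) (B.e' j)) = 0 ∧
    B.f' j (ξ (B.e i) (B.e' j)) = 0 ∧
    B.f' j (ξ (B.e i) (B.e' i)) = 0 ∧
    B.f' j (ξ (B.f j) (B.e' i)) = 0 ∧
    B.f' i (ξ B.em (B.e' i)) = 0 ∧
    B.f' j (ξ (B.f i) (B.f' i)) = 0 ∧
    B.f' j (ξ (B.f j) (B.f' i)) = 0 := by
  obtain ⟨hpos, -⟩ := hlam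
  have hself (u : L) (α : Dual ℝ L) : α (ξ u α) = 0 := by linarith [hskew u α α]
  have c_f {k l : Fin n} (hkl : k ≠ l) : B.f' l (ξ (B.f k) (B.e' l)) = 0 := by
    have h := hcoc.apply_lie B.em (B.e k) (B.e' l) (B.f' l)
    simpa [B.lie_em_e, B.coad_em_e', B.coad_em_f', B.coad_e_e', B.coad_e_f'_of_ne hkl, hself,
      (hpos k).ne'] using h
  have c_e {k l : Fin n} (hkl : k ≠ l) : B.f' l (ξ (B.e k) (B.e' l)) = 0 := by
    have h := hcoc.apply_lie B.em (B.f k) (B.e' l) (B.f' l)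
    simpa [B.lie_em_f, B.coad_em_e', B.coad_em_f', B.coad_f_e'_of_ne hkl, B.coad_f_f', hself,
      (hpos k).ne'] using h
  have hji := hij.symm
  refine ⟨?_, ?_, c_f hij, c_e hij, ?_, ?_, ?_, ?_, ?_⟩
  · have h := hcoc.apply_lie (B.e i) (B.f j) B.e0' (B.e' i)
    simp [B.lie_e_f_of_ne hij, B.coad_e_e0', B.coad_e_e', B.coad_f_e0', B.coad_f_e'_of_ne hji] at h
    linarith [c_f hji, hskew (B.f j) (B.e' i) (B.f' i), hskew (B.e i) (B.e' i) (B.e' j)]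
  · have h := hcoc.apply_lie (B.e j) (B.f i) B.e0' (B.e' j)
    simp [B.lie_e_f_of_ne hji, B.coad_e_e0', B.coad_e_e', B.coad_f_e0', B.coad_f_e'_of_ne hij] at h
    linarith [c_f hij, hskew (B.f i) (B.e' j) (B.f' j)]
  · have h := hcoc.apply_lie (B.e i) (B.e j) B.e0' (B.e' i)
    simp [B.lie_e_e, B.coad_e_e0', B.coad_e_e'] at h
    linarith [c_e hji, hskew (B.e j) (B.e' i) (B.f' i), hskew (B.e i) (B.e' i) (B.f' j)]
  · have h := hcoc.apply_lie (B.f i) (B.f j) B.e0' (B.f' j)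
    simp [B.lie_f_f, B.coad_f_e0', B.coad_f_f'] at h
    linarith [c_f hij]
  · have h₁ := hcoc.apply_lie B.em (B.f i) B.e0' (B.f' i)
    have h₂ := hcoc.apply_lie B.em (B.e i) B.e0' (B.e' i)
    simp [B.lie_em_f, B.coad_em_e0', B.coad_em_f', B.coad_f_e0', B.coad_f_f'] at h₁
    simp [B.lie_em_e, B.coad_em_e0', B.coad_em_e', B.coad_e_e0', B.coad_e_e'] at h₂
    linarith [hskew B.em (B.e' i) (B.f' i)]
  · have h := hcoc.apply_lie (B.e j) (B.f i) B.e0' (B.f' i)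
    simp [B.lie_e_f_of_ne hji, B.coad_e_e0', B.coad_e_f'_of_ne hji, B.coad_f_e0',
      B.coad_f_f'] at h
    linarith [c_e hji, hskew (B.f i) (B.f' i) (B.f' j)]
  · have h := hcoc.apply_lie (B.e i) (B.f j) B.e0' (B.f' j)
    simp [B.lie_e_f_of_ne hij, B.coad_e_e0', B.coad_e_f'_of_ne hij, B.coad_f_e0',
      B.coad_f_f'] at h
    linarith [c_e hij]
end
end
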